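/- Let f ∈ AC¹ and let x ∈ (−1,1) be irrational. For every real number L with |L| ≤ 2|E(f,x)|/π there exists a strictly increasing sequence (n_j) of even positive integers such that n_j (B_{n_j}(f,x) − f(x)) → L as j → ∞. -/

import Mathlib

open Filter Set MeasureTheory

noncomputable section

/-- Equally spaced nodes `x_{k,n} = 2k/n - 1`. -/
def node (n k : ℕ) : ℝ := 2 * k / n - 1

/-- `x` is one of the nodes `x_{0,n}, …, x_{n,n}`. -/
def isNode (n : ℕ) (x : ℝ) : Prop := ∃ k ≤ n, x = node n k

/-- Denominator of Berrut's interpolant. -/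
def Dden (n : ℕ) (x : ℝ) : ℝ :=
  ∑ k ∈ Finset.range (n + 1), (-1 : ℝ) ^ k / (x - node n k)

/-- Numerator of Berrut's interpolant. -/
def Nnum (f : ℝ → ℝ) (n : ℕ) (x : ℝ) : ℝ :=
  ∑ k ∈ Finset.range (n + 1), (-1 : ℝ) ^ k * f (node n k) / (x - node n k)

open Classical in
/-- Berrut's barycentric interpolant. -/
def berrut (f : ℝ → ℝ) (n : ℕ) (x : ℝ) : ℝ :=
  if isNode n x then f x else Nnum f n x / Dden n x

/-- The odd bias function `O(f,x)`. -/
def Ofun (f : ℝ → ℝ) (x : ℝ) : ℝ :=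
  (f x - f 1) / (2 * (x - 1)) - (f x - f (-1)) / (2 * (x + 1))

/-- The even bias function `E(f,x)`. -/
def Efun (f : ℝ → ℝ) (x : ℝ) : ℝ :=
  (f 1 - f x) / (2 * (x - 1)) + (f (-1) - f x) / (2 * (x + 1))

/-- `f` is differentiable on `[-1,1]` with absolutely continuous derivative. -/
def AC1 (f : ℝ → ℝ) : Prop :=
  ∃ f' : ℝ → ℝ,
    (∀ x ∈ Set.Icc (-1 : ℝ) 1, HasDerivWithinAt f (f' x) (Set.Icc (-1 : ℝ) 1) x) ∧
    ∃ g : ℝ → ℝ, IntervalIntegrable g volume (-1) 1 ∧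
      ∀ x ∈ Set.Icc (-1 : ℝ) 1, f' x = f' (-1) + ∫ t in (-1 : ℝ)..x, g t

/-- `x` is regular for the sequence `n j`: eventually never a node. -/
def Regular (n : ℕ → ℕ) (x : ℝ) : Prop := ∃ j₀, ∀ j ≥ j₀, ¬ isNode (n j) x

/-- The function `A(x) = Σ (-1)^k (4k+2)/((2k+1)^2 - x)`. -/
def Afun (x : ℝ) : ℝ := ∑' k : ℕ, (-1 : ℝ) ^ k * (4 * k + 2) / ((2 * k + 1) ^ 2 - x)

/-- `ι_n(x) = ⌊n(x+1)/2⌋`. -/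
def iota (n : ℕ) (x : ℝ) : ℤ := ⌊(n : ℝ) * (x + 1) / 2⌋

/-- `ρ_n(x) = n(x - x_{ι_n(x),n}) - 1 = n(x+1) - 2 ι_n(x) - 1`. -/
def rho (n : ℕ) (x : ℝ) : ℝ := (n : ℝ) * (x + 1) - 2 * (iota n x : ℝ) - 1

open Classical in
/-- The de-biased numerator `Δ_n(f,x)`. -/
def Delta (f : ℝ → ℝ) (n : ℕ) (x : ℝ) : ℝ :=
  if isNode n x then 0 else
    (f (-1) - f x) / (2 * (x + 1)) + (-1 : ℝ) ^ n * (f 1 - f x) / (2 * (x - 1)) +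
      (1 / (n : ℝ)) * ∑ k ∈ Finset.Ioo 0 n, (-1 : ℝ) ^ k * (f (node n k) - f x) / (x - node n k)

end


lemma alt_bound (M : ℕ) : ∀ a : ℝ, 0 < a →
    0 ≤ ∑ i ∈ Finset.range M, (-1 : ℝ) ^ i / (a + i) ∧
    ∑ i ∈ Finset.range M, (-1 : ℝ) ^ i / (a + i) ≤ 1 / a := by
  induction M with
  | zero => intro a ha; simp; positivity
  | succ M ih =>
    intro a ha
    obtain ⟨h1, h2⟩ := ih (a + 1) (by linarith)
    have e : ∑ i ∈ Finset.range (M + 1), (-1 : ℝ) ^ i / (a + i)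
        = 1 / a - ∑ i ∈ Finset.range M, (-1 : ℝ) ^ i / (a + 1 + i) := by
      rw [Finset.sum_range_succ', add_comm, sub_eq_add_neg, ← Finset.sum_neg_distrib]
      congr 1
      · simp
      · refine Finset.sum_congr rfl fun i _ => ?_
        push_cast
        rw [pow_succ, show a + ((i : ℝ) + 1) = a + 1 + i by ring]; ring
    have h3 : 1 / (a + 1) ≤ 1 / a := one_div_le_one_div_of_le ha (by linarith)
    rw [e]; constructor <;> linarith

lemma cot_tendsto (θ : ℝ) (hθ : ∀ k : ℤ, θ ≠ k) :
    Tendsto (fun N : ℕ => ∑ j ∈ Finset.range N, (1 / (θ - (j + 1)) + 1 / (θ + (j + 1)))) atTop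
      (nhds (Real.pi * Real.cot (Real.pi * θ) - 1 / θ)) := by
  have hz : (θ : ℂ) ∈ Complex.integerComplement := by
    rw [Complex.mem_integerComplement_iff]
    rintro ⟨k, hk⟩
    exact hθ k (by exact_mod_cast hk.symm)
  have := tendsto_logDeriv_euler_cot_sub hz
  have h2 := (Complex.continuous_re.tendsto _).comp this
  convert h2 using 1
  · ext N
    simp only [Function.comp, cotTerm]
    rw [← Complex.ofReal_re (∑ j ∈ Finset.range N, (1 / (θ - (j + 1)) + 1 / (θ + (j + 1))))]
    push_cast
    rfl
  · rw [← Complex.ofReal_re (Real.pi * Real.cot (Real.pi * θ) - 1 / θ)]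
    push_cast
    rfl

lemma csc_tendsto (θ : ℝ) (hθ : ∀ k : ℤ, θ ≠ k) :
    Tendsto (fun N : ℕ => 1 / θ + ∑ j ∈ Finset.range (2 * N),
      (-1 : ℝ) ^ (j + 1) * (1 / (θ - (j + 1)) + 1 / (θ + (j + 1)))) atTop
      (nhds (Real.pi / Real.sin (Real.pi * θ))) := by
  have h1 := cot_tendsto θ hθ
  have h2 := cot_tendsto (θ / 2) (fun k hk => hθ (2 * k) (by push_cast; linarith))
  have h3 : Tendsto (fun N : ℕ => 2 * N) atTop atTop :=
    tendsto_id.const_mul_atTop' (by norm_num)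
  have h4 := ((h2.sub (h1.comp h3)).const_add (1 / θ))
  have hs : Real.sin (Real.pi * θ) ≠ 0 := by
    intro h
    rw [Real.sin_eq_zero_iff] at h
    obtain ⟨k, hk⟩ := h
    apply hθ k
    have := Real.pi_pos.ne'
    field_simp at hk
    linarith
  have hth : θ ≠ 0 := by simpa using hθ 0
  convert h4 using 1
  · ext N
    congr 1
    simp only [Function.comp]
    induction N with
    | zero => simp
    | succ N ih =>
      rw [show 2 * (N + 1) = 2 * N + 1 + 1 by ring, Finset.sum_range_succ, Finset.sum_range_succ,
        Finset.sum_range_succ, Finset.sum_range_succ, Finset.sum_range_succ, ih]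
      have e1 : θ / 2 - (N + 1) = (θ - (2 * N + 1 + 1)) / 2 := by ring
      have e2 : θ / 2 + (N + 1) = (θ + (2 * N + 1 + 1)) / 2 := by ring
      rw [e1, e2]
      have e3 : (-1 : ℝ) ^ (2 * N + 1) = -1 := by simp [pow_succ, pow_mul]
      have e4 : (-1 : ℝ) ^ (2 * N + 1 + 1) = 1 := by simp [pow_succ, pow_mul]
      rw [e3, e4]
      push_cast
      rw [one_div_div, one_div_div]
      ring
  · congr 1
    have h5 : Real.pi * θ = 2 * (Real.pi * (θ / 2)) := by ring
    rw [Real.cot_eq_cos_div_sin, Real.cot_eq_cos_div_sin]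
    rw [h5, Real.sin_two_mul] at hs
    rw [h5, Real.sin_two_mul, Real.cos_two_mul]
    set s := Real.sin (Real.pi * (θ / 2))
    set c := Real.cos (Real.pi * (θ / 2))
    have hs0 : s ≠ 0 := by rintro h; simp [h] at hs
    have hc0 : c ≠ 0 := by rintro h; simp [h] at hs
    field_simp
    ring

lemma csc_bound (m : ℕ) (θ : ℝ) (hθ : ∀ k : ℤ, θ ≠ k) (h0 : 0 < θ) (h1 : θ < 2 * m) :
    |∑ k ∈ Finset.range (2 * m + 1), (-1 : ℝ) ^ k / (θ - k) - Real.pi / Real.sin (Real.pi * θ)|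
      ≤ 1 / θ + 1 / (2 * m - θ) := by
  have h := ((csc_tendsto θ hθ).const_sub
    (∑ k ∈ Finset.range (2 * m + 1), (-1 : ℝ) ^ k / (θ - k))).abs
  refine le_of_tendsto h ?_
  filter_upwards [eventually_ge_atTop m] with N hN
  obtain ⟨r, rfl⟩ := Nat.exists_eq_add_of_le hN
  have e : (∑ k ∈ Finset.range (2 * m + 1), (-1 : ℝ) ^ k / (θ - k))
      - (1 / θ + ∑ j ∈ Finset.range (2 * (m + r)),
      (-1 : ℝ) ^ (j + 1) * (1 / (θ - (j + 1)) + 1 / (θ + (j + 1))))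
      = (∑ j ∈ Finset.range (2 * (m + r)), (-1 : ℝ) ^ j / (θ + 1 + j))
        - ∑ i ∈ Finset.range (2 * r), (-1 : ℝ) ^ i / (2 * m + 1 - θ + i) := by
    simp only [mul_add, Finset.sum_add_distrib]
    rw [Finset.sum_range_succ', Finset.sum_range_add (fun j : ℕ => (-1 : ℝ) ^ (j + 1) * (1 / (θ - (j + 1)))) (2 * m) (2 * r)]
    have a1 : ∑ k ∈ Finset.range (2 * m), (-1 : ℝ) ^ (k + 1) / (θ - ((k + 1 : ℕ) : ℝ))
      = ∑ k ∈ Finset.range (2 * m), (-1 : ℝ) ^ (k + 1) * (1 / (θ - (k + 1))) := by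
      refine Finset.sum_congr rfl fun i _ => ?_
      push_cast; ring
    have a2 : ∑ x ∈ Finset.range (2 * r), (-1 : ℝ) ^ (2 * m + x + 1) * (1 / (θ - (((2 * m + x : ℕ) : ℝ) + 1)))
      = ∑ i ∈ Finset.range (2 * r), (-1 : ℝ) ^ i / (2 * m + 1 - θ + i) := by
      refine Finset.sum_congr rfl fun i _ => ?_
      have : (-1 : ℝ) ^ (2 * m + i + 1) = - (-1) ^ i := by simp [pow_succ, pow_add, pow_mul]
      rw [this]
      push_cast
      rw [show θ - (2 * (m : ℝ) + i + 1) = - (2 * m + 1 - θ + i) by ring, one_div, inv_neg]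
      ring
    have a3 : ∑ x ∈ Finset.range (2 * m + 2 * r), (-1 : ℝ) ^ (x + 1) * (1 / (θ + (x + 1)))
      = - ∑ j ∈ Finset.range (2 * m + 2 * r), (-1 : ℝ) ^ j / (θ + 1 + j) := by
      rw [← Finset.sum_neg_distrib]
      refine Finset.sum_congr rfl fun i _ => ?_
      rw [pow_succ, show θ + ((i : ℝ) + 1) = θ + 1 + i by ring]; ring
    rw [a1, a2, a3]
    simp
    ring
  rw [e]
  obtain ⟨b1, b2⟩ := alt_bound (2 * (m + r)) (θ + 1) (by linarith)
  obtain ⟨b3, b4⟩ := alt_bound (2 * r) (2 * m + 1 - θ) (by linarith)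
  have b5 : 1 / (θ + 1) ≤ 1 / θ := one_div_le_one_div_of_le h0 (by linarith)
  have b6 : 1 / (2 * m + 1 - θ) ≤ 1 / (2 * m - θ) := one_div_le_one_div_of_le (by linarith) (by linarith)
  rw [abs_le]; constructor <;> linarith

lemma sin_cluster (α : ℝ) (hα : Irrational α) (σ : ℝ) (h1 : |σ| ≤ 1) :
    ∃ ψ : ℕ → ℕ, StrictMono ψ ∧ Tendsto (fun j => Real.sin (Real.pi * (ψ j * α))) atTop (nhds σ) := by
  have hp := Real.pi_pos
  have : Fact (0 < 2 * Real.pi) := ⟨by positivity⟩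
  have hd : DenseRange (· • ((Real.pi * α : ℝ) : AddCircle (2 * Real.pi)) : ℤ → AddCircle (2 * Real.pi)) := by
    rw [AddCircle.denseRange_zsmul_coe_iff]
    rw [show Real.pi * α / (2 * Real.pi) = α / (2 : ℕ) by push_cast; field_simp]
    exact hα.div_natCast (by norm_num)
  have hm := ((mapClusterPt_atTop_nsmul_tfae ((Real.arcsin σ : ℝ) : AddCircle (2 * Real.pi))
    ((Real.pi * α : ℝ) : AddCircle (2 * Real.pi))).out 0 3).2 (hd _)
  obtain ⟨ψ, hψ, ht⟩ := hm.tendsto_subseq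
  refine ⟨ψ, hψ, ?_⟩
  have hc : Continuous (Real.Angle.sin) := Real.Angle.continuous_sin
  have := (hc.tendsto _).comp ht
  have e : Real.Angle.sin ((Real.arcsin σ : ℝ) : Real.Angle) = σ := by
    rw [Real.Angle.sin_coe, Real.sin_arcsin (abs_le.1 h1).1 (abs_le.1 h1).2]
  change Tendsto _ _ (nhds (Real.Angle.sin ((Real.arcsin σ : ℝ) : Real.Angle))) at this
  rw [e] at this
  convert this using 1
  ext j
  change _ = Real.Angle.sin (ψ j • ((Real.pi * α : ℝ) : Real.Angle))
  rw [← Real.Angle.coe_nsmul, Real.Angle.sin_coe]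
  congr 1
  simp; ring

/-- alternating sum of integrals over a partition -/
noncomputable def altT (g : ℝ → ℝ) (y : ℕ → ℝ) (m : ℕ) : ℝ :=
  ∑ i ∈ Finset.range m, ((∫ t in y (2 * i)..y (2 * i + 1), g t)
    - ∫ t in y (2 * i + 1)..y (2 * i + 2), g t)

lemma altT_bound (g : ℝ → ℝ) (hg : Integrable g) (y : ℕ → ℝ) (hy : Monotone y) (m : ℕ) :
    |altT g y m| ≤ ∫ t, |g t| := by
  have h1 : |altT g y m| ≤ ∫ t in y 0..y (2 * m), |g t| := by
    unfold altT
    induction m with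
    | zero => simp
    | succ m ih =>
      rw [Finset.sum_range_succ]
      have hi : ∀ a b, IntervalIntegrable (fun t => |g t|) volume a b :=
        fun a b => hg.abs.intervalIntegrable
      rw [← intervalIntegral.integral_add_adjacent_intervals (hi (y 0) (y (2 * m))) (hi _ _),
        ← intervalIntegral.integral_add_adjacent_intervals (hi (y (2 * m)) (y (2 * m + 1))) (hi _ (y (2 * (m + 1))))]
      have a1 := intervalIntegral.abs_integral_le_integral_abs (f := g) (μ := volume)
        (hy (show 2 * m ≤ 2 * m + 1 by omega))
      have a2 := intervalIntegral.abs_integral_le_integral_abs (f := g) (μ := volume)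
        (hy (show 2 * m + 1 ≤ 2 * (m + 1) by omega))
      have a3 := abs_sub (∫ t in y (2 * m)..y (2 * m + 1), g t) (∫ t in y (2 * m + 1)..y (2 * m + 2), g t)
      refine (abs_add_le _ _).trans ?_
      have : 2 * (m + 1) = 2 * m + 2 := by ring
      rw [this] at a2 ⊢
      linarith
  refine h1.trans ?_
  rw [intervalIntegral.integral_of_le (hy (by omega))]
  exact setIntegral_le_integral hg.abs (Eventually.of_forall fun t => abs_nonneg _)

lemma altT_cont (q : ℝ → ℝ) (hq : Continuous q) (y : ℕ → ℝ) (δ ε : ℝ) (hδ : 0 ≤ δ)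
    (hy : ∀ k, y (k + 1) = y k + δ) (hu : ∀ u, |q u - q (u + δ)| ≤ ε) (m : ℕ) :
    |altT q y m| ≤ m * (ε * δ) := by
  unfold altT
  refine (Finset.abs_sum_le_sum_abs _ _).trans ?_
  refine (Finset.sum_le_card_nsmul _ _ (ε * δ) ?_).trans (by simp)
  intro i _
  have e : (∫ t in y (2 * i + 1)..y (2 * i + 2), q t) = ∫ t in y (2 * i)..y (2 * i + 1), q (t + δ) := by
    rw [intervalIntegral.integral_comp_add_right, hy (2 * i + 1), ← hy (2 * i)]
  rw [e, ← intervalIntegral.integral_sub (hq.intervalIntegrable _ _)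
    ((by fun_prop : Continuous fun t => q (t + δ)).intervalIntegrable _ _)]
  have := intervalIntegral.norm_integral_le_of_norm_le_const (a := y (2 * i)) (b := y (2 * i + 1))
    (f := fun t => q t - q (t + δ)) (C := ε) (fun u _ => hu u)
  rw [hy, add_sub_cancel_left, abs_of_nonneg hδ] at this
  rw [hy]
  exact this

lemma altT_sub (g q : ℝ → ℝ) (hg : Integrable g) (hq : Integrable q) (y : ℕ → ℝ) (m : ℕ) :
    altT g y m = altT (fun t => g t - q t) y m + altT q y m := by
  unfold altT
  rw [← Finset.sum_add_distrib]
  refine Finset.sum_congr rfl fun i _ => ?_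
  rw [intervalIntegral.integral_sub hg.intervalIntegrable hq.intervalIntegrable,
    intervalIntegral.integral_sub hg.intervalIntegrable hq.intervalIntegrable]
  ring

lemma altT_tendsto (g : ℝ → ℝ) (hg : Integrable g) (a b : ℝ) (hb : 0 ≤ b) :
    Tendsto (fun m : ℕ => altT g (fun k => a + b * k / (2 * m)) m) atTop (nhds 0) := by
  rw [Metric.tendsto_atTop]
  intro ε hε
  obtain ⟨q, hqc, hgq, hq, hqi⟩ := hg.exists_hasCompactSupport_integral_sub_le (half_pos hε)
  have huc := hq.uniformContinuous_of_tendsto_cocompact hqc.is_zero_at_infty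
  rw [Metric.uniformContinuous_iff] at huc
  obtain ⟨d, hd, hud⟩ := huc (ε / (b + 1)) (by positivity)
  have ht : Tendsto (fun m : ℕ => b / 2 / (m : ℝ)) atTop (nhds 0) :=
    tendsto_const_nhds.div_atTop tendsto_natCast_atTop_atTop
  obtain ⟨M, hM⟩ := eventually_atTop.1 ((ht.eventually_lt_const hd).and (eventually_gt_atTop 0))
  refine ⟨M, fun m hm => ?_⟩
  obtain ⟨h1, h2⟩ := hM m hm
  have hmp : (0 : ℝ) < m := by exact_mod_cast h2
  rw [Real.dist_eq, sub_zero, altT_sub g q hg hqi]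
  have b1 := altT_bound (fun t => g t - q t) (hg.sub hqi) (fun k => a + b * k / (2 * m))
    (fun i j hij => by
      have : (i : ℝ) ≤ j := by exact_mod_cast hij
      simp only; gcongr) m
  have b2 := altT_cont q hq (fun k => a + b * k / (2 * m)) (b / 2 / m) (ε / (b + 1)) (by positivity)
    (fun k => by push_cast; field_simp; ring) (fun u => by
      have := @hud u (u + b / 2 / m) (by
        rw [Real.dist_eq, sub_add_cancel_left, abs_neg, abs_of_nonneg (by positivity)]; exact h1)
      rw [Real.dist_eq] at this; exact this.le) m
  have b3 : (m : ℝ) * (ε / (b + 1) * (b / 2 / m)) = ε / 2 * (b / (b + 1)) := by field_simp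
  have b4 : b / (b + 1) < 1 := by rw [div_lt_one (by positivity)]; linarith
  have b5 : ε / 2 * (b / (b + 1)) < ε / 2 := by nlinarith
  simp only [Real.norm_eq_abs] at hgq
  have := abs_add_le (altT (fun t => g t - q t) (fun k => a + b * k / (2 * m)) m)
    (altT q (fun k => a + b * k / (2 * m)) m)
  linarith

lemma alt_sum_even (h : ℕ → ℝ) (m : ℕ) :
    ∑ k ∈ Finset.range (2 * m + 1), (-1 : ℝ) ^ k * h k
      = (h 0 + h (2 * m)) / 2 - 1 / 2 * ∑ i ∈ Finset.range m,
        (2 * h (2 * i + 1) - h (2 * i) - h (2 * i + 2)) := by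
  induction m with
  | zero => simp
  | succ m ih =>
    rw [show 2 * (m + 1) + 1 = 2 * m + 1 + 1 + 1 by ring, Finset.sum_range_succ,
      Finset.sum_range_succ, ih, Finset.sum_range_succ]
    have e3 : (-1 : ℝ) ^ (2 * m + 1) = -1 := by simp [pow_succ, pow_mul]
    have e4 : (-1 : ℝ) ^ (2 * m + 1 + 1) = 1 := by simp [pow_succ, pow_mul]
    rw [e3, e4, show 2 * (m + 1) = 2 * m + 2 by ring]
    ring

lemma num_tendsto (g : ℝ → ℝ) (hg : Integrable g) (c x : ℝ)  :
    Tendsto (fun m : ℕ => ∑ i ∈ Finset.range m,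
      (2 * (∫ s in (0:ℝ)..1, (c + ∫ t in (-1:ℝ)..(x + s * (2 * ((2 * i + 1 : ℕ) : ℝ) / (2 * m : ℕ) - 1 - x)), g t))
      - (∫ s in (0:ℝ)..1, (c + ∫ t in (-1:ℝ)..(x + s * (2 * ((2 * i : ℕ) : ℝ) / (2 * m : ℕ) - 1 - x)), g t))
      - (∫ s in (0:ℝ)..1, (c + ∫ t in (-1:ℝ)..(x + s * (2 * ((2 * i + 2 : ℕ) : ℝ) / (2 * m : ℕ) - 1 - x)), g t))))
      atTop (nhds 0) := by
  have hG : Continuous fun y => ∫ t in (-1:ℝ)..y, g t :=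
    intervalIntegral.continuous_primitive (fun a b => hg.intervalIntegrable) _
  have hGc : ∀ t : ℝ, Continuous fun s : ℝ => (c + ∫ u in (-1:ℝ)..(x + s * (t - x)), g u) :=
    fun t => (continuous_const.add (hG.comp (by fun_prop : Continuous fun s : ℝ => x + s * (t - x))))
  have key : ∀ (m : ℕ) (s : ℝ), ∑ i ∈ Finset.range m,
      (2 * (c + ∫ t in (-1:ℝ)..(x + s * (2 * ((2 * i + 1 : ℕ) : ℝ) / (2 * m : ℕ) - 1 - x)), g t)
      - (c + ∫ t in (-1:ℝ)..(x + s * (2 * ((2 * i : ℕ) : ℝ) / (2 * m : ℕ) - 1 - x)), g t)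
      - (c + ∫ t in (-1:ℝ)..(x + s * (2 * ((2 * i + 2 : ℕ) : ℝ) / (2 * m : ℕ) - 1 - x)), g t))
      = altT g (fun k => (x - s * (x + 1)) + (2 * s) * k / (2 * m)) m := by
    intro m s
    unfold altT
    refine Finset.sum_congr rfl fun i _ => ?_
    have hp : ∀ k : ℕ, x + s * (2 * (k : ℝ) / (2 * m : ℕ) - 1 - x)
      = (x - s * (x + 1)) + (2 * s) * k / (2 * m) := by intro k; push_cast; ring
    simp only [hp]
    have hi : ∀ a b, IntervalIntegrable g volume a b := fun a b => hg.intervalIntegrable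
    have hh : ∀ a b, (∫ t in a..b, g t) = (∫ t in (-1:ℝ)..b, g t) - ∫ t in (-1:ℝ)..a, g t :=
      fun a b => (intervalIntegral.integral_interval_sub_left (hi (-1) b) (hi (-1) a)).symm
    rw [hh (x - s * (x + 1) + 2 * s * ((2 * i : ℕ) : ℝ) / (2 * m)),
      hh (x - s * (x + 1) + 2 * s * ((2 * i + 1 : ℕ) : ℝ) / (2 * m))]
    ring
  have e : ∀ m : ℕ, ∑ i ∈ Finset.range m,
      (2 * (∫ s in (0:ℝ)..1, (c + ∫ t in (-1:ℝ)..(x + s * (2 * ((2 * i + 1 : ℕ) : ℝ) / (2 * m : ℕ) - 1 - x)), g t))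
      - (∫ s in (0:ℝ)..1, (c + ∫ t in (-1:ℝ)..(x + s * (2 * ((2 * i : ℕ) : ℝ) / (2 * m : ℕ) - 1 - x)), g t))
      - (∫ s in (0:ℝ)..1, (c + ∫ t in (-1:ℝ)..(x + s * (2 * ((2 * i + 2 : ℕ) : ℝ) / (2 * m : ℕ) - 1 - x)), g t)))
      = ∫ s in (0:ℝ)..1, altT g (fun k => (x - s * (x + 1)) + (2 * s) * k / (2 * m)) m := by
    intro m
    simp only [← key]
    rw [intervalIntegral.integral_finsetSum]
    · refine Finset.sum_congr rfl fun i _ => ?_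
      rw [intervalIntegral.integral_sub, intervalIntegral.integral_sub,
        intervalIntegral.integral_const_mul]
      · exact ((hGc _).const_mul _).intervalIntegrable _ _
      · exact (hGc _).intervalIntegrable _ _
      · exact (((hGc _).const_mul _).sub (hGc _)).intervalIntegrable _ _
      · exact (hGc _).intervalIntegrable _ _
    · intro i _
      exact ((((hGc _).const_mul _).sub (hGc _)).sub (hGc _)).intervalIntegrable _ _
  simp only [e]
  have h00 : (∫ s in (0:ℝ)..1, (0:ℝ)) = 0 := by simp
  suffices hsuf : Tendsto (fun m : ℕ => ∫ s in (0:ℝ)..1,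
      altT g (fun k => (x - s * (x + 1)) + (2 * s) * k / (2 * m)) m) atTop
      (nhds (∫ s in (0:ℝ)..1, (0:ℝ))) by rwa [h00] at hsuf
  refine intervalIntegral.tendsto_integral_filter_of_dominated_convergence
    (fun _ => ∫ t, |g t|) ?_ ?_ ?_ ?_
  · refine Eventually.of_forall fun m => ?_
    simp only [← key]
    refine (Continuous.aestronglyMeasurable ?_)
    exact continuous_finsetSum _ fun i _ => (((hGc _).const_mul _).sub (hGc _)).sub (hGc _)
  · refine Eventually.of_forall fun m => Eventually.of_forall fun s hs => ?_
    rw [uIoc_of_le zero_le_one] at hs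
    have := hs.1.le
    refine altT_bound g hg _ (fun i j hij => ?_) m
    have : (i : ℝ) ≤ j := by exact_mod_cast hij
    gcongr
  · exact intervalIntegrable_const
  · refine Eventually.of_forall fun s hs => ?_
    rw [uIoc_of_le zero_le_one] at hs
    exact altT_tendsto g hg _ _ (by linarith [hs.1])

lemma taylor_int (f : ℝ → ℝ) (F : ℝ → ℝ) (hF : Continuous F) (x t : ℝ)
    (hx : x ∈ Set.Ioo (-1 : ℝ) 1) (ht : t ∈ Set.Icc (-1 : ℝ) 1)
    (hf : ∀ y ∈ Set.Icc (-1 : ℝ) 1, HasDerivWithinAt f (F y) (Set.Icc (-1 : ℝ) 1) y) (hxt : x ≠ t) :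
    (f t - f x) / (x - t) = - ∫ s in (0:ℝ)..1, F (x + s * (t - x)) := by
  have hm : ∀ s ∈ Set.Icc (0:ℝ) 1, x + s * (t - x) ∈ Set.Icc (-1 : ℝ) 1 := by
    intro s hs
    have h := convex_Icc (-1 : ℝ) 1 (Set.Ioo_subset_Icc_self hx) ht (sub_nonneg.2 hs.2) hs.1 (by ring)
    simp only [smul_eq_mul] at h
    convert h using 1; ring
  have hm' : ∀ s ∈ Set.Ioo (0:ℝ) 1, x + s * (t - x) ∈ Set.Ioo (-1 : ℝ) 1 := by
    intro s hs
    obtain ⟨h0, h1⟩ := hs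
    obtain ⟨h2, h3⟩ := hx
    obtain ⟨h4, h5⟩ := ht
    constructor <;> nlinarith [mul_pos h0 (sub_pos.2 h1)]
  have hcf : ContinuousOn f (Set.Icc (-1) 1) := fun y hy => (hf y hy).continuousWithinAt
  have hi := intervalIntegral.integral_eq_sub_of_hasDerivAt_of_le (a := 0) (b := 1)
    (f := fun s => f (x + s * (t - x))) (f' := fun s => F (x + s * (t - x)) * (t - x)) zero_le_one
    (hcf.comp (by fun_prop) hm) (fun s hs => by
      have h1 := (hf _ (Set.Ioo_subset_Icc_self (hm' s hs))).hasDerivAt (Icc_mem_nhds (hm' s hs).1 (hm' s hs).2)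
      have h2 : HasDerivAt (fun s : ℝ => x + s * (t - x)) (t - x) s := by
        simpa using ((hasDerivAt_id s).mul_const (t - x)).const_add x
      exact h1.comp s h2)
    ((by fun_prop : Continuous fun s => F (x + s * (t - x)) * (t - x)).intervalIntegrable _ _)
  rw [intervalIntegral.integral_mul_const] at hi
  simp only [one_mul, zero_mul, add_zero, add_sub_cancel] at hi
  rw [← hi]
  have : x - t ≠ 0 := sub_ne_zero.2 hxt
  field_simp
  ring

lemma node_mem (n k : ℕ) (hn : 0 < n) (hk : k ≤ n) : node n k ∈ Set.Icc (-1 : ℝ) 1 := by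
  unfold node
  have h1 : (0 : ℝ) < n := by exact_mod_cast hn
  have h2 : (k : ℝ) ≤ n := by exact_mod_cast hk
  have h3 : 2 * (k : ℝ) / n ≤ 2 := by rw [div_le_iff₀ h1]; linarith
  have h4 : 0 ≤ 2 * (k : ℝ) / n := by positivity
  constructor <;> linarith

lemma node_ne (n k : ℕ) (x : ℝ) (hx : Irrational x) : x ≠ node n k := by
  intro h
  apply hx
  refine ⟨2 * k / n - 1, ?_⟩
  rw [h, node]; push_cast; rfl

lemma Num_tendsto (f : ℝ → ℝ) (hf : AC1 f) (x : ℝ) (hx : x ∈ Set.Ioo (-1 : ℝ) 1)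
    (hirr : Irrational x) :
    Tendsto (fun m : ℕ => ∑ k ∈ Finset.range (2 * m + 1),
      (-1 : ℝ) ^ k * ((f (node (2 * m) k) - f x) / (x - node (2 * m) k))) atTop
      (nhds (Efun f x)) := by
  obtain ⟨f', hf', g₀, hg₀, hfg⟩ := hf
  set g : ℝ → ℝ := (Set.Ioc (-1 : ℝ) 1).indicator g₀ with hgdef
  have hg : Integrable g := by
    rw [intervalIntegrable_iff_integrableOn_Ioc_of_le (by norm_num)] at hg₀
    exact hg₀.integrable_indicator measurableSet_Ioc
  set c := f' (-1)
  set F : ℝ → ℝ := fun y => c + ∫ t in (-1:ℝ)..y, g t with hFdef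
  have hF : Continuous F := continuous_const.add
    (intervalIntegral.continuous_primitive (fun a b => hg.intervalIntegrable) _)
  have hfF : ∀ y ∈ Set.Icc (-1 : ℝ) 1, f' y = F y := by
    intro y hy
    rw [hfg y hy, hFdef]
    simp only
    congr 1
    rw [intervalIntegral.integral_of_le hy.1, intervalIntegral.integral_of_le hy.1]
    refine setIntegral_congr_fun measurableSet_Ioc fun t ht => ?_
    rw [hgdef, Set.indicator_of_mem]
    exact ⟨ht.1, ht.2.trans hy.2⟩
  have hd : ∀ y ∈ Set.Icc (-1 : ℝ) 1, HasDerivWithinAt f (F y) (Set.Icc (-1 : ℝ) 1) y :=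
    fun y hy => hfF y hy ▸ hf' y hy
  have h := ((num_tendsto g hg c x).const_mul (1 / 2)).const_add (Efun f x)
  rw [mul_zero, add_zero] at h
  refine h.congr' ?_
  filter_upwards [eventually_gt_atTop 0] with m hm
  rw [alt_sum_even (fun k => (f (node (2 * m) k) - f x) / (x - node (2 * m) k)), sub_eq_add_neg]
  have hmr : (m : ℝ) ≠ 0 := by positivity
  congr 1
  · have e0 : node (2 * m) 0 = -1 := by simp [node]
    have e1 : node (2 * m) (2 * m) = 1 := by
      unfold node; push_cast; field_simp; norm_num
    simp only [e0, e1]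
    unfold Efun
    have : x - 1 ≠ 0 := by linarith [hx.2]
    have : x + 1 ≠ 0 := by linarith [hx.1]
    rw [sub_neg_eq_add]
    field_simp
    ring
  · rw [← mul_neg, ← Finset.sum_neg_distrib]
    congr 1
    refine Finset.sum_congr rfl fun i hi => ?_
    have hi' := Finset.mem_range.1 hi
    have hk : ∀ k ≤ 2 * m, (f (node (2 * m) k) - f x) / (x - node (2 * m) k)
        = - ∫ s in (0:ℝ)..1, (c + ∫ t in (-1:ℝ)..(x + s * (2 * (k : ℝ) / (2 * m : ℕ) - 1 - x)), g t) :=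
      fun k hk => taylor_int f F hF x _ hx (node_mem _ _ (by omega) hk) hd (node_ne _ _ _ hirr)
    rw [hk _ (by omega), hk _ (by omega), hk _ (by omega)]
    ring

lemma Dden_eq (m : ℕ) (hm : 0 < m) (x : ℝ) :
    Dden (2 * m) x = m * ∑ k ∈ Finset.range (2 * m + 1), (-1 : ℝ) ^ k / (m * (x + 1) - k) := by
  unfold Dden node
  rw [Finset.mul_sum]
  refine Finset.sum_congr rfl fun k _ => ?_
  have hmr : (m : ℝ) ≠ 0 := by positivity
  have : x - (2 * (k : ℝ) / (2 * m : ℕ) - 1) = (m * (x + 1) - k) / m := by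
    push_cast; field_simp; ring
  rw [this, div_div_eq_mul_div]; ring

lemma Sw_tendsto (x : ℝ) (hx : x ∈ Set.Ioo (-1 : ℝ) 1) (hirr : Irrational x) :
    Tendsto (fun m : ℕ => (∑ k ∈ Finset.range (2 * m + 1), (-1 : ℝ) ^ k / (m * (x + 1) - k))
      * Real.sin (Real.pi * (m * (x + 1)))) atTop (nhds Real.pi) := by
  have h1 : 0 < x + 1 := by linarith [hx.1]
  have h2 : 0 < 1 - x := by linarith [hx.2]
  have ht : ∀ a : ℝ, 0 < a → Tendsto (fun m : ℕ => 1 / ((m : ℝ) * a)) atTop (nhds 0) := fun a ha =>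
    tendsto_const_nhds.div_atTop (tendsto_natCast_atTop_atTop.atTop_mul_const ha)
  have he := (ht _ h1).add (ht _ h2)
  rw [add_zero] at he
  rw [tendsto_iff_norm_sub_tendsto_zero]
  refine squeeze_zero' (Eventually.of_forall fun m => norm_nonneg _) ?_ he
  filter_upwards [eventually_gt_atTop 0] with m hm
  have hmr : (0 : ℝ) < m := by exact_mod_cast hm
  have hirr1 : Irrational ((m : ℝ) * (x + 1)) := by
    have : Irrational (x + (1 : ℕ)) := hirr.add_natCast 1
    push_cast at this
    exact this.natCast_mul hm.ne'
  have hni : ∀ k : ℤ, (m : ℝ) * (x + 1) ≠ k := fun k hk => hirr1 ⟨k, by rw [hk]; simp⟩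
  have hb := csc_bound m (m * (x + 1)) hni (by positivity) (by nlinarith [hx.2])
  rw [show 2 * (m : ℝ) - m * (x + 1) = m * (1 - x) by ring] at hb
  refine le_trans ?_ hb
  set S := ∑ k ∈ Finset.range (2 * m + 1), (-1 : ℝ) ^ k / (m * (x + 1) - k)
  set w := Real.sin (Real.pi * (m * (x + 1))) with hw
  have hs : w ≠ 0 := by
    intro h
    rw [hw, Real.sin_eq_zero_iff] at h
    obtain ⟨k, hk⟩ := h
    apply hni k
    have := Real.pi_pos.ne'
    have : Real.pi * k = Real.pi * (m * (x + 1)) := by linarith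
    exact (mul_left_cancel₀ ‹_› this).symm
  have : S * w - Real.pi = (S - Real.pi / w) * w := by field_simp
  rw [this, norm_mul]
  exact mul_le_of_le_one_right (abs_nonneg _) (Real.abs_sin_le_one _)

lemma berrut_eq (f : ℝ → ℝ) (n : ℕ) (x : ℝ) (hirr : Irrational x) (hD : Dden n x ≠ 0) :
    berrut f n x - f x = (∑ k ∈ Finset.range (n + 1),
      (-1 : ℝ) ^ k * ((f (node n k) - f x) / (x - node n k))) / Dden n x := by
  have hn : ¬ isNode n x := by
    rintro ⟨k, _, hk⟩
    exact node_ne _ _ _ hirr hk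
  rw [berrut, if_neg hn, eq_div_iff hD, sub_mul, div_mul_cancel₀ _ hD, Nnum, Dden, Finset.mul_sum,
    ← Finset.sum_sub_distrib]
  refine Finset.sum_congr rfl fun k _ => ?_
  ring

/-- for `f ∈ AC¹` and irrational `x ∈ (-1,1)`, every real `L` with
`|L| ≤ 2|E(f,x)|/π` is attained as a limit of `n_j (B_{n_j}(f,x) - f(x))` along some
even sequence. -/
theorem statement6 (f : ℝ → ℝ) (hf : AC1 f) (x : ℝ) (hx : x ∈ Set.Ioo (-1 : ℝ) 1)
    (hirr : Irrational x) (L : ℝ) (hL : |L| ≤ 2 * |Efun f x| / Real.pi) :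
    ∃ n : ℕ → ℕ, StrictMono n ∧ (∀ j, Even (n j) ∧ 0 < n j) ∧
      Filter.Tendsto (fun j : ℕ => (n j : ℝ) * (berrut f (n j) x - f x))
        Filter.atTop (nhds L) := by
  set E := Efun f x with hE
  have hp := Real.pi_pos
  obtain ⟨σ, hσ1, hσ2⟩ : ∃ σ : ℝ, |σ| ≤ 1 ∧ 2 * (E * σ) / Real.pi = L := by
    rcases eq_or_ne E 0 with h | h
    · refine ⟨0, by simp, ?_⟩
      rw [h] at hL
      simp at hL
      simp [hL]
    · refine ⟨Real.pi * L / (2 * E), ?_, by field_simp⟩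
      rw [abs_div, abs_mul, abs_mul, abs_of_pos hp, abs_two, div_le_one (by positivity)]
      rw [le_div_iff₀ hp] at hL
      linarith
  obtain ⟨ψ, hψ, ht⟩ := sin_cluster (x + 1) (by simpa using hirr.add_natCast 1) σ hσ1
  have hψ' : StrictMono (fun j => ψ (j + 1)) := fun i j hij => hψ (by omega)
  have hpos : ∀ j, 0 < ψ (j + 1) := fun j => (Nat.succ_pos j).trans_le (hψ.id_le (j + 1))
  refine ⟨fun j => 2 * ψ (j + 1), fun i j hij => by have := hψ' hij; simp only at this ⊢; omega,
    fun j => ⟨even_two_mul _, Nat.mul_pos two_pos (hpos j)⟩, ?_⟩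
  have t1 := (Num_tendsto f hf x hx hirr).comp hψ'.tendsto_atTop
  have t2 := (Sw_tendsto x hx hirr).comp hψ'.tendsto_atTop
  have t3 := ht.comp (tendsto_add_atTop_nat 1)
  have t4 := ((t1.mul t3).const_mul 2).div t2 hp.ne'
  rw [← hE, hσ2] at t4
  refine t4.congr' ?_
  filter_upwards [t2.eventually_ne hp.ne'] with j hj
  simp only [Function.comp, Pi.div_apply] at hj ⊢
  have hm := hpos j
  set m := ψ (j + 1)
  have hmr : (m : ℝ) ≠ 0 := by positivity
  have hS := left_ne_zero_of_mul hj
  have hw := right_ne_zero_of_mul hj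
  have hD := Dden_eq m hm x
  rw [berrut_eq f (2 * m) x hirr (by rw [hD]; exact mul_ne_zero hmr hS), hD]
  generalize Real.sin (Real.pi * (m * (x + 1))) = w at hw ⊢
  generalize (∑ k ∈ Finset.range (2 * m + 1), (-1 : ℝ) ^ k / (m * (x + 1) - k)) = S at hS ⊢
  generalize (∑ k ∈ Finset.range (2 * m + 1), (-1 : ℝ) ^ k * ((f (node (2 * m) k) - f x) / (x - node (2 * m) k))) = Q
  push_cast
  field_simp
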